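/- Sharpness of the weak-type exponent for the Riesz potential: Let 0 < α < n, 1 ≤ p < n/α, and define q by 1/q = 1/p − α/n. Then for every exponent γ with 0 ≤ γ < 1 − α/n there is NO constant c such that ‖I_α f‖_{L^{q,∞}(w^q)} ≤ c [w]_{A_{p,q}}^{γ} ‖w·f‖_{L^{p}(ℝⁿ)} holds for all weights w ∈ A_{p,q} and all measurable f; equivalently, the supremum of [w]_{A_{p,q}}^{-γ} · ‖I_α‖_{L^p(w^p) → L^{q,∞}(w^q)} over all w ∈ A_{p,q} is infinite. -/

import Mathlib

open MeasureTheory ENNReal Set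

noncomputable section

/-- Euclidean space `ℝⁿ`. -/
abbrev Euc (n : ℕ) := EuclideanSpace ℝ (Fin n)

variable {n : ℕ}

/-- The axis-parallel closed cube with lower corner `a` and side length `h`. -/
def Cube (a : Euc n) (h : ℝ) : Set (Euc n) :=
  {x | ∀ i, a i ≤ x i ∧ x i ≤ a i + h}

/-- The weighted measure `u(E) = ∫_E u dx` of a set. -/
def wMeas (u : Euc n → ℝ) (E : Set (Euc n)) : ℝ≥0∞ :=
  ∫⁻ x in E, ENNReal.ofReal (u x)

/-- The dual exponent `p' = p/(p-1)`. -/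
def dualExp (p : ℝ) : ℝ := p / (p - 1)

/-- The `A_{p,q}` constant of a weight `w` (with the `A_{1,q}` convention when `p = 1`). -/
def Apq (p q : ℝ) (w : Euc n → ℝ) : ℝ≥0∞ :=
  ⨆ (a : Euc n) (h : ℝ) (_ : 0 < h),
    ((volume (Cube a h))⁻¹ * ∫⁻ x in Cube a h, ENNReal.ofReal (w x) ^ q) *
      (if p = 1 then
        (essSup (fun x => (ENNReal.ofReal (w x))⁻¹) (volume.restrict (Cube a h))) ^ q
      else
        ((volume (Cube a h))⁻¹ * ∫⁻ x in Cube a h,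
            ENNReal.ofReal (w x) ^ (-(dualExp p))) ^ (q / dualExp p))

/-- The weighted Lebesgue norm `‖w f‖_{L^p(ℝⁿ)}`. -/
def wLp (w f : Euc n → ℝ) (p : ℝ) : ℝ≥0∞ :=
  (∫⁻ x, (ENNReal.ofReal (w x) * ENNReal.ofReal |f x|) ^ p) ^ (1 / p)

/-- The weighted Lebesgue norm `‖w g‖_{L^q(ℝⁿ)}` of an `ℝ≥0∞`-valued function. -/
def wLpE (w : Euc n → ℝ) (g : Euc n → ℝ≥0∞) (q : ℝ) : ℝ≥0∞ :=
  (∫⁻ x, (ENNReal.ofReal (w x) * g x) ^ q) ^ (1 / q)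

/-- The weak norm `‖g‖_{L^{q,∞}(u)} = sup_{λ>0} λ u({|g|>λ})^{1/q}`. -/
def weakLp (u : Euc n → ℝ) (g : Euc n → ℝ) (q : ℝ) : ℝ≥0∞ :=
  ⨆ (t : ℝ) (_ : 0 < t), ENNReal.ofReal t * wMeas u {x | t < |g x|} ^ (1 / q)

/-- The weak norm of an `ℝ≥0∞`-valued function. -/
def weakLpE (u : Euc n → ℝ) (g : Euc n → ℝ≥0∞) (q : ℝ) : ℝ≥0∞ :=
  ⨆ (t : ℝ) (_ : 0 < t), ENNReal.ofReal t * wMeas u {x | ENNReal.ofReal t < g x} ^ (1 / q)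

/-- The fractional integral (Riesz potential) `I_α f(x) = ∫ |f(y)| |x-y|^{α-n} dy`. -/
def riesz (α : ℝ) (f : Euc n → ℝ) (x : Euc n) : ℝ≥0∞ :=
  ∫⁻ y, ENNReal.ofReal |f y| * ENNReal.ofReal (‖x - y‖ ^ (α - (n : ℝ)))

/-- The fractional maximal operator `M_α f(x) = sup_{Q ∋ x} |Q|^{α/n-1} ∫_Q |f|`. -/
def fracMax (α : ℝ) (f : Euc n → ℝ) (x : Euc n) : ℝ≥0∞ :=
  ⨆ (a : Euc n) (h : ℝ) (_ : 0 < h) (_ : x ∈ Cube a h),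
    volume (Cube a h) ^ (α / (n : ℝ) - 1) * ∫⁻ y in Cube a h, ENNReal.ofReal |f y|

/-- surface constant -/
def sC (n : ℕ) : ℝ := n * (volume : Measure (Euc n)).real (Metric.ball 0 1)

lemma sC_pos (hn : 0 < n) : 0 < sC n := by
  unfold sC
  have : 0 < (volume : Measure (Euc n)).real (Metric.ball 0 1) := by
    rw [measureReal_def, ENNReal.toReal_pos_iff]
    exact ⟨Metric.measure_ball_pos _ _ one_pos, measure_ball_lt_top⟩
  have : (0:ℝ) < n := by exact_mod_cast hn
  positivity

lemma radial (hn : 0 < n) (F : ℝ → ℝ) (hF : ∀ y, 0 ≤ F y)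
    (hi : IntegrableOn (fun y : ℝ => y ^ (n - 1) * F y) (Ioi 0)) :
    ∫⁻ x : Euc n, ENNReal.ofReal (F ‖x‖) =
      ENNReal.ofReal (sC n * ∫ y in Ioi (0:ℝ), y ^ (n - 1) * F y) := by
  have : Nonempty (Fin n) := ⟨⟨0, hn⟩⟩
  have : Nontrivial (Euc n) := inferInstance
  have h1 := (integrable_fun_norm_addHaar (volume : Measure (Euc n)) (f := F)).2 (by simpa using hi)
  rw [← ofReal_integral_eq_lintegral_ofReal h1 (Filter.Eventually.of_forall fun x => hF _),
    integral_fun_norm_addHaar (volume : Measure (Euc n)) F]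
  simp [sC, mul_assoc]

lemma pow_mul_rpow (hn : 0 < n) {y : ℝ} (hy : 0 < y) (e : ℝ) :
    y ^ (n - 1) * y ^ (e - n) = y ^ (e - 1) := by
  rw [← Real.rpow_natCast, ← Real.rpow_add hy, Nat.cast_sub hn]
  congr 1; push_cast; ring

lemma ball_int (hn : 0 < n) {e R : ℝ} (he : 0 < e) (hR : 0 < R) :
    ∫⁻ x in {x : Euc n | ‖x‖ < R}, ENNReal.ofReal (‖x‖ ^ (e - n)) =
      ENNReal.ofReal (sC n * (R ^ e / e)) := by
  have hm : MeasurableSet {x : Euc n | ‖x‖ < R} := measurableSet_lt measurable_norm measurable_const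
  set F : ℝ → ℝ := (Ico 0 R).indicator (fun y => y ^ (e - n)) with hF
  have key : EqOn (fun y : ℝ => y ^ (n - 1) * F y) ((Ioo 0 R).indicator fun y => y ^ (e - 1))
      (Ioi 0) := by
    intro y hy
    have hy : 0 < y := hy
    by_cases h : y < R
    · simp [hF, indicator, h, hy, hy.le, pow_mul_rpow hn hy]
    · simp [hF, indicator, h]
  have hi : IntegrableOn (fun y : ℝ => y ^ (e - 1)) (Ioo 0 R) := by
    have := (intervalIntegral.intervalIntegrable_rpow' (a := 0) (b := R) (r := e - 1) (by linarith))
    rw [intervalIntegrable_iff_integrableOn_Ioo_of_le hR.le] at this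
    exact this
  have hsub : Ioo 0 R ⊆ Ioi (0:ℝ) := fun y hy => hy.1
  have h := radial hn F (fun y => indicator_nonneg (fun y hy => Real.rpow_nonneg hy.1 _) y) (by
    rw [integrableOn_congr_fun key measurableSet_Ioi]
    exact ((integrable_indicator_iff measurableSet_Ioo).2 hi).integrableOn)
  rw [setIntegral_congr_fun measurableSet_Ioi key, setIntegral_indicator measurableSet_Ioo,
    inter_eq_self_of_subset_right hsub, ← integral_Ioc_eq_integral_Ioo,
    ← intervalIntegral.integral_of_le hR.le, integral_rpow (Or.inl (by linarith))] at h
  have h0 : (0:ℝ) ^ e = 0 := Real.zero_rpow he.ne'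
  simp only [sub_add_cancel, h0, sub_zero] at h
  rw [← h, ← lintegral_indicator hm]
  congr 1; ext x
  by_cases h : ‖x‖ < R <;> simp [hF, indicator, h]

lemma shell_int (hn : 0 < n) {r : ℝ} (hr : 0 < r) (hr1 : r ≤ 1) :
    ∫⁻ x in {x : Euc n | r ≤ ‖x‖ ∧ ‖x‖ ≤ 1}, ENNReal.ofReal (‖x‖ ^ (0 - n : ℝ)) =
      ENNReal.ofReal (sC n * Real.log (1 / r)) := by
  have hm : MeasurableSet {x : Euc n | r ≤ ‖x‖ ∧ ‖x‖ ≤ 1} :=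
    (measurableSet_le measurable_const measurable_norm).inter
      (measurableSet_le measurable_norm measurable_const)
  set F : ℝ → ℝ := (Icc r 1).indicator (fun y => y ^ (0 - n : ℝ)) with hF
  have key : EqOn (fun y : ℝ => y ^ (n - 1) * F y) ((Icc r 1).indicator fun y => y⁻¹)
      (Ioi 0) := by
    intro y hy
    have hy : 0 < y := hy
    by_cases h : y ∈ Icc r 1
    · simp only [hF, indicator_of_mem h]
      rw [pow_mul_rpow hn hy, zero_sub, Real.rpow_neg_one]
    · simp [hF, indicator_of_notMem h]
  have hi : IntegrableOn (fun y : ℝ => y⁻¹) (Icc r 1) := by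
    apply ContinuousOn.integrableOn_Icc
    exact continuousOn_inv₀.mono fun y hy => (hr.trans_le hy.1).ne'
  have hsub : Icc r 1 ⊆ Ioi (0:ℝ) := fun y hy => hr.trans_le hy.1
  have h := radial hn F (fun y => indicator_nonneg (fun y hy => Real.rpow_nonneg (hr.le.trans hy.1) _) y) (by
    rw [integrableOn_congr_fun key measurableSet_Ioi]
    exact ((integrable_indicator_iff measurableSet_Icc).2 hi).integrableOn)
  rw [setIntegral_congr_fun measurableSet_Ioi key, setIntegral_indicator measurableSet_Icc,
    inter_eq_self_of_subset_right hsub, integral_Icc_eq_integral_Ioc,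
    ← intervalIntegral.integral_of_le hr1, integral_inv_of_pos hr one_pos] at h
  rw [← h, ← lintegral_indicator hm]
  congr 1; ext x
  by_cases h : r ≤ ‖x‖ ∧ ‖x‖ ≤ 1 <;> simp [hF, indicator, h]

lemma cube_vol (a : Euc n) {h : ℝ} (hh : 0 < h) : volume (Cube a h) = ENNReal.ofReal (h ^ n) := by
  have : Cube a h = (WithLp.ofLp : Euc n → (Fin n → ℝ)) ⁻¹'
      (Icc (a.ofLp) (fun i => a i + h)) := by
    ext x; simp [Cube, Pi.le_def, forall_and]
  rw [this, (PiLp.volume_preserving_ofLp (Fin n)).measure_preimage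
    measurableSet_Icc.nullMeasurableSet, Real.volume_Icc_pi]
  simp [ENNReal.ofReal_pow hh.le]

lemma cube_meas (a : Euc n) (h : ℝ) : MeasurableSet (Cube a h) := by
  have : Cube a h = (WithLp.ofLp : Euc n → (Fin n → ℝ)) ⁻¹'
      (Icc (a.ofLp) (fun i => a i + h)) := by
    ext x; simp [Cube, Pi.le_def, forall_and]
  rw [this]
  exact (PiLp.volume_preserving_ofLp (Fin n)).measurable measurableSet_Icc

lemma cube_diam {a x y : Euc n} {h : ℝ} (hh : 0 < h) (hx : x ∈ Cube a h) (hy : y ∈ Cube a h) :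
    ‖x‖ ≤ ‖y‖ + √n * h := by
  have h1 : ‖x - y‖ ≤ √n * h := by
    rw [EuclideanSpace.norm_eq]
    have : √n * h = √(n * h ^ 2) := by
      rw [Real.sqrt_mul (by positivity), Real.sqrt_sq hh.le]
    rw [this]
    apply Real.sqrt_le_sqrt
    calc ∑ i, ‖(x - y) i‖ ^ 2 ≤ ∑ i : Fin n, h ^ 2 := by
          apply Finset.sum_le_sum
          intro i _
          apply pow_le_pow_left₀ (norm_nonneg _)
          have := hx i; have := hy i
          simp only [PiLp.sub_apply, Real.norm_eq_abs, abs_le]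
          constructor <;> linarith
      _ = n * h ^ 2 := by simp
  have := norm_sub_norm_le x y
  linarith

/-- the weight -/
def pw (n : ℕ) (δ q : ℝ) (x : Euc n) : ℝ := ‖x‖ ^ ((δ - n) / q)

lemma pw_rpow {δ q : ℝ} (hq : 0 < q) (x : Euc n) : pw n δ q x ^ q = ‖x‖ ^ (δ - n) := by
  rw [pw, ← Real.rpow_mul (norm_nonneg _), div_mul_cancel₀ _ hq.ne']

lemma pw_nonneg {δ q : ℝ} (x : Euc n) : 0 ≤ pw n δ q x := Real.rpow_nonneg (norm_nonneg _) _

lemma ofReal_pw_rpow {δ q : ℝ} (hq : 0 < q) (x : Euc n) :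
    ENNReal.ofReal (pw n δ q x) ^ q = ENNReal.ofReal (‖x‖ ^ (δ - n)) := by
  rw [ENNReal.ofReal_rpow_of_nonneg (pw_nonneg x) hq.le, pw_rpow hq]

lemma pw_meas (δ q : ℝ) : Measurable (pw n δ q) := by
  unfold pw; fun_prop

lemma ae_ne_zero (hn : 0 < n) : ∀ᵐ x : Euc n, x ≠ 0 := by
  have : Nonempty (Fin n) := ⟨⟨0, hn⟩⟩
  have : Nontrivial (Euc n) := inferInstance
  simp [ae_iff]

lemma second_factor (hn : 0 < n) {δ p q M h : ℝ} (hδ : δ < n) (hp : 1 ≤ p) (hq : 0 < q)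
    (hM : 0 < M) (hh : 0 < h) (a : Euc n) (hQ : ∀ x ∈ Cube a h, ‖x‖ ≤ M) :
    (if p = 1 then
        (essSup (fun x => (ENNReal.ofReal (pw n δ q x))⁻¹) (volume.restrict (Cube a h))) ^ q
      else
        ((volume (Cube a h))⁻¹ * ∫⁻ x in Cube a h,
            ENNReal.ofReal (pw n δ q x) ^ (-(dualExp p))) ^ (q / dualExp p))
      ≤ ENNReal.ofReal (M ^ (n - δ)) := by
  set K : ℝ≥0∞ := ENNReal.ofReal (M ^ ((n - δ) / q)) with hK
  have hKq : K ^ q = ENNReal.ofReal (M ^ (n - δ)) := by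
    rw [hK, ENNReal.ofReal_rpow_of_nonneg (by positivity) hq.le, ← Real.rpow_mul hM.le,
      div_mul_cancel₀ _ hq.ne']
  have hae : ∀ᵐ x ∂(volume.restrict (Cube a h)), (ENNReal.ofReal (pw n δ q x))⁻¹ ≤ K := by
    filter_upwards [ae_restrict_mem (cube_meas a h), ae_restrict_of_ae (ae_ne_zero hn)] with x hx h0
    have hx0 : 0 < ‖x‖ := norm_pos_iff.2 h0
    have : 0 < pw n δ q x := Real.rpow_pos_of_pos hx0 _
    rw [← ENNReal.ofReal_inv_of_pos this, hK]
    apply ENNReal.ofReal_le_ofReal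
    rw [pw, ← Real.rpow_neg hx0.le]
    have : -((δ - n) / q) = (n - δ) / q := by ring
    rw [this]
    exact Real.rpow_le_rpow hx0.le (hQ x hx) (div_nonneg (by linarith) hq.le)
  rw [← hKq]
  split_ifs with h1
  · exact ENNReal.rpow_le_rpow (essSup_le_of_ae_le _ hae) hq.le
  · have hp1 : 1 < p := lt_of_le_of_ne hp (Ne.symm h1)
    have hd : 0 < dualExp p := div_pos (by linarith) (by linarith)
    have hv0 : volume (Cube a h) ≠ 0 := by
      rw [cube_vol a hh]; simp; positivity
    have hvt : volume (Cube a h) ≠ ⊤ := by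
      rw [cube_vol a hh]; simp
    have h2 : (volume (Cube a h))⁻¹ * ∫⁻ x in Cube a h,
            ENNReal.ofReal (pw n δ q x) ^ (-(dualExp p)) ≤ K ^ dualExp p := by
      calc _ ≤ (volume (Cube a h))⁻¹ * ∫⁻ x in Cube a h, K ^ dualExp p := by
            gcongr 1
            apply lintegral_mono_ae
            filter_upwards [hae] with x hx
            rw [ENNReal.rpow_neg, ← ENNReal.inv_rpow]
            exact ENNReal.rpow_le_rpow hx hd.le
        _ = K ^ dualExp p := by
            rw [setLIntegral_const, mul_comm (K ^ _), ← mul_assoc, ENNReal.inv_mul_cancel hv0 hvt,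
              one_mul]
    calc _ ≤ (K ^ dualExp p) ^ (q / dualExp p) := ENNReal.rpow_le_rpow h2 (by positivity)
      _ = K ^ q := by
        rw [← ENNReal.rpow_mul, mul_div_cancel₀ _ hd.ne']

/-- constant in the bound of the weight characteristic -/
def cA (n : ℕ) : ℝ := sC n * (1 + √n) ^ n + (1 + √n) ^ (2 * n)

lemma cA_pos (hn : 0 < n) : 0 < cA n := by
  have := sC_pos hn
  unfold cA; positivity

lemma Apq_le (hn : 0 < n) {δ p q : ℝ} (hδ0 : 0 < δ) (hδ : δ < 1) (hp : 1 ≤ p) (hq : 0 < q) :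
    Apq p q (pw n δ q) ≤ ENNReal.ofReal (cA n / δ) := by
  have hn1 : (1:ℝ) ≤ n := by exact_mod_cast hn
  have hs := sC_pos hn
  set B : ℝ := 1 + √n with hB
  have hB1 : 1 ≤ B := by have := Real.sqrt_nonneg n; linarith
  have hB0 : 0 < B := by linarith
  refine iSup_le fun a => iSup_le fun h => iSup_le fun hh => ?_
  simp_rw [ofReal_pw_rpow hq]
  have hv : (volume (Cube a h))⁻¹ = ENNReal.ofReal ((h ^ n)⁻¹) := by
    rw [cube_vol a hh, ENNReal.ofReal_inv_of_pos (by positivity)]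
  have haQ : a ∈ Cube a h := fun i => ⟨le_rfl, by linarith⟩
  by_cases hc : ∃ x ∈ Cube a h, ‖x‖ < h
  · obtain ⟨x₀, hx₀, hx₀h⟩ := hc
    have hlt : ∀ x ∈ Cube a h, ‖x‖ < B * h := fun x hx => by
      have := cube_diam hh hx hx₀
      rw [hB]; linarith
    have h2 := second_factor (p := p) (q := q) (δ := δ) hn (by linarith) hp hq
      (mul_pos hB0 hh) hh a (fun x hx => (hlt x hx).le)
    have h1 : ∫⁻ x in Cube a h, ENNReal.ofReal (‖x‖ ^ (δ - n)) ≤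
        ENNReal.ofReal (sC n * ((B * h) ^ δ / δ)) := by
      rw [← ball_int hn hδ0 (mul_pos hB0 hh)]
      exact lintegral_mono_set hlt
    refine (mul_le_mul' (mul_le_mul' le_rfl h1) h2).trans ?_
    rw [hv, ← ENNReal.ofReal_mul (by positivity), ← ENNReal.ofReal_mul (by positivity)]
    apply ENNReal.ofReal_le_ofReal
    have e1 : (B * h) ^ δ * (B * h) ^ (n - δ) = B ^ n * h ^ n := by
      rw [← Real.rpow_add (mul_pos hB0 hh), add_sub_cancel, Real.rpow_natCast, mul_pow]
    calc (h ^ n)⁻¹ * (sC n * ((B * h) ^ δ / δ)) * (B * h) ^ (n - δ)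
        = (h ^ n)⁻¹ * sC n / δ * ((B * h) ^ δ * (B * h) ^ (n - δ)) := by ring
      _ = sC n * B ^ n / δ := by
        rw [e1]; field_simp
      _ ≤ cA n / δ := by
        gcongr
        rw [cA, ← hB]
        have : 0 ≤ B ^ (2 * n) := by positivity
        linarith
  · push Not at hc
    have hm := hc a haQ
    set m := ‖a‖ with hmdef
    have hm0 : 0 < m := by linarith
    have hup : ∀ x ∈ Cube a h, ‖x‖ ≤ B * m := fun x hx => by
      have := cube_diam hh hx haQ
      have : √n * h ≤ √n * m := by gcongr
      rw [hB]; linarith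
    have hlo : ∀ x ∈ Cube a h, m / B ≤ ‖x‖ := fun x hx => by
      have := cube_diam hh haQ hx
      have : √n * h ≤ √n * ‖x‖ := by gcongr; exact hc x hx
      rw [div_le_iff₀ hB0, hB]; linarith
    have h2 := second_factor (p := p) (q := q) (δ := δ) hn (by linarith) hp hq
      (mul_pos hB0 hm0) hh a hup
    have h1 : ∫⁻ x in Cube a h, ENNReal.ofReal (‖x‖ ^ (δ - n)) ≤
        ENNReal.ofReal ((m / B) ^ (δ - n) * h ^ n) := by
      rw [ENNReal.ofReal_mul (by positivity), ← cube_vol a hh, ← setLIntegral_const]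
      apply setLIntegral_mono' (cube_meas a h)
      intro x hx
      apply ENNReal.ofReal_le_ofReal
      exact Real.rpow_le_rpow_of_nonpos (by positivity) (hlo x hx) (by linarith)
    refine (mul_le_mul' (mul_le_mul' le_rfl h1) h2).trans ?_
    rw [hv, ← ENNReal.ofReal_mul (by positivity), ← ENNReal.ofReal_mul (by positivity)]
    apply ENNReal.ofReal_le_ofReal
    have e1 : (m / B) ^ (δ - n) * (B * m) ^ (n - δ) = (B ^ 2) ^ (n - δ) := by
      rw [← neg_sub (n:ℝ) δ, Real.rpow_neg (by positivity), ← Real.inv_rpow (by positivity),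
        ← Real.mul_rpow (by positivity) (by positivity)]
      congr 1; field_simp
    calc (h ^ n)⁻¹ * ((m / B) ^ (δ - n) * h ^ n) * (B * m) ^ (n - δ)
        = (m / B) ^ (δ - n) * (B * m) ^ (n - δ) := by field_simp
      _ = (B ^ 2) ^ (n - δ) := e1
      _ ≤ (B ^ 2) ^ (n : ℝ) := Real.rpow_le_rpow_of_exponent_le (one_le_pow₀ hB1) (by linarith)
      _ = B ^ (2 * n) := by rw [Real.rpow_natCast, pow_mul]
      _ ≤ cA n := by
        rw [cA, ← hB]
        have : 0 ≤ sC n * B ^ n := by positivity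
        linarith
      _ ≤ cA n / δ := by
        rw [le_div_iff₀ hδ0]
        nlinarith [cA_pos hn]

/-- test function -/
def tf (n : ℕ) (α r : ℝ) : Euc n → ℝ :=
  {x : Euc n | r ≤ ‖x‖ ∧ ‖x‖ ≤ 1}.indicator fun x => ‖x‖ ^ (-α)

lemma shell_meas (r : ℝ) : MeasurableSet {x : Euc n | r ≤ ‖x‖ ∧ ‖x‖ ≤ 1} :=
  (measurableSet_le measurable_const measurable_norm).inter
      (measurableSet_le measurable_norm measurable_const)

lemma tf_meas (α r : ℝ) : Measurable (tf n α r) :=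
  Measurable.indicator (by fun_prop) (shell_meas r)

lemma riesz_lower (hn : 0 < n) {α r : ℝ} (hαn : α < n) (hr : 0 < r) (hr1 : r ≤ 1) {x : Euc n}
    (hx : ‖x‖ < r) :
    ENNReal.ofReal (2 ^ (α - n) * (sC n * Real.log (1 / r))) ≤ riesz α (tf n α r) x := by
  rw [ENNReal.ofReal_mul (by positivity), ← shell_int hn hr hr1,
    ← lintegral_const_mul' _ _ ENNReal.ofReal_ne_top]
  refine le_trans ?_ (setLIntegral_le_lintegral {x : Euc n | r ≤ ‖x‖ ∧ ‖x‖ ≤ 1} _)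
  apply setLIntegral_mono' (shell_meas r)
  intro y hy
  have hy0 : 0 < ‖y‖ := hr.trans_le hy.1
  rw [tf, indicator_of_mem hy, ← ENNReal.ofReal_mul (by positivity), ← ENNReal.ofReal_mul (by positivity)]
  apply ENNReal.ofReal_le_ofReal
  rw [abs_of_nonneg (by positivity)]
  have hxy : 0 < ‖x - y‖ := by
    rw [norm_pos_iff, sub_ne_zero]
    rintro rfl
    exact absurd hy.1 (not_le.2 hx)
  have h2 : ‖x - y‖ ≤ 2 * ‖y‖ := by
    have := norm_sub_le x y
    have := hy.1
    linarith
  calc (2:ℝ) ^ (α - n) * ‖y‖ ^ (0 - n : ℝ) = ‖y‖ ^ (-α) * (2 * ‖y‖) ^ (α - n) := by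
        rw [Real.mul_rpow (by norm_num) hy0.le, mul_left_comm, ← Real.rpow_add hy0]
        congr 2; ring
    _ ≤ _ := by
        gcongr 1
        exact Real.rpow_le_rpow_of_nonpos hxy h2 (by linarith)

lemma wLp_le (hn : 0 < n) {α p q δ r : ℝ} (hp : 1 ≤ p) (hq0 : 0 < q)
    (hq : 1 / q = 1 / p - α / n) (hδ : 0 < δ) (hr : 0 < r) :
    wLp (pw n δ q) (tf n α r) p ≤
      ENNReal.ofReal ((sC n * (2 ^ (δ * p / q) / (δ * p / q))) ^ (1 / p)) := by
  have hp0 : 0 < p := by linarith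
  have he : 0 < δ * p / q := by positivity
  have hs := sC_pos hn
  have hn0 : (n:ℝ) ≠ 0 := by exact_mod_cast hn.ne'
  rw [wLp, ← ENNReal.ofReal_rpow_of_nonneg (by positivity) (by positivity)]
  apply ENNReal.rpow_le_rpow _ (by positivity)
  rw [← ball_int hn he two_pos,
    ← lintegral_indicator (measurableSet_lt measurable_norm measurable_const)]
  apply lintegral_mono
  intro x
  by_cases hx : r ≤ ‖x‖ ∧ ‖x‖ ≤ 1
  · have hx2 : x ∈ {x : Euc n | ‖x‖ < 2} := by
      show ‖x‖ < 2
      linarith [hx.2]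
    have hx0 : 0 < ‖x‖ := hr.trans_le hx.1
    have hxs : x ∈ {x : Euc n | r ≤ ‖x‖ ∧ ‖x‖ ≤ 1} := hx
    simp only [indicator_of_mem hx2, tf, indicator_of_mem hxs]
    rw [abs_of_nonneg (by positivity), ← ENNReal.ofReal_mul (pw_nonneg x), pw, ← Real.rpow_add hx0,
      ENNReal.ofReal_rpow_of_nonneg (by positivity) hp0.le, ← Real.rpow_mul hx0.le]
    apply le_of_eq
    congr 2
    have : (n:ℝ) / q = n / p - α := by
      rw [div_eq_mul_one_div, hq]; field_simp
    rw [sub_div, this]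
    field_simp
    ring
  · have hxs : x ∉ {x : Euc n | r ≤ ‖x‖ ∧ ‖x‖ ≤ 1} := hx
    simp only [tf, indicator_of_notMem hxs]
    simp [hp0]

/-- Sharpness of the exponent `1 - α/n` in the weak-type bound for the Riesz
potential (Theorem 2.4, sharpness part). -/
theorem riesz_weak_type_exponent_sharp
    (n : ℕ) (hn : 0 < n) (α p q : ℝ) (hα : 0 < α) (hαn : α < n)
    (hp : 1 ≤ p) (hpn : p < n / α) (hq : 1 / q = 1 / p - α / n)
    (γ : ℝ) (hγ0 : 0 ≤ γ) (hγ : γ < 1 - α / n) :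
    ¬ ∃ c : ℝ, 0 < c ∧ ∀ w f : Euc n → ℝ, Measurable w → (∀ x, 0 ≤ w x) → Measurable f →
      Apq p q w < ⊤ →
      weakLpE (fun x => w x ^ q) (riesz α f) q ≤
        ENNReal.ofReal c * Apq p q w ^ γ * wLp w f p := by
  rintro ⟨c, hc, H⟩
  have hp0 : 0 < p := by linarith
  have hn0 : (0:ℝ) < n := by exact_mod_cast hn
  have hs := sC_pos hn
  have hcA := cA_pos hn
  have hq0 : 0 < q := by
    rw [← one_div_pos, hq, sub_pos, div_lt_div_iff₀ hn0 hp0]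
    rw [lt_div_iff₀ hα] at hpn
    linarith
  set A : ℝ := 2 ^ (α - n) * sC n / 2 * (sC n * Real.exp (-1)) ^ (1 / q) with hA
  set C : ℝ := c * cA n ^ γ * (sC n * 2 ^ (p / q) / (p / q)) ^ (1 / p) with hC
  have hA0 : 0 < A := by positivity
  have key : ∀ N : ℝ, 1 < N → N ^ (1 - α / n - γ) ≤ C / A := by
    intro N hN
    have hN0 : 0 < N := by linarith
    set δ : ℝ := N⁻¹ with hδ
    have hδ0 : 0 < δ := by positivity
    have hδ1 : δ < 1 := inv_lt_one_of_one_lt₀ hN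
    set r : ℝ := Real.exp (-N) with hr
    have hr0 : 0 < r := Real.exp_pos _
    have hr1 : r ≤ 1 := by rw [hr, Real.exp_le_one_iff]; linarith
    have hlog : Real.log (1 / r) = N := by rw [one_div, Real.log_inv, hr, Real.log_exp, neg_neg]
    have hrδ : r ^ δ = Real.exp (-1) := by
      rw [hr, ← Real.exp_mul, hδ]; congr 1; field_simp
    have hAp := Apq_le hn hδ0 hδ1 hp hq0
    have h := H (pw n δ q) (tf n α r) (pw_meas _ _) pw_nonneg (tf_meas _ _)
      (hAp.trans_lt ENNReal.ofReal_lt_top)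
    set t : ℝ := 2 ^ (α - n) * sC n / 2 * N with ht
    have ht0 : 0 < t := by positivity
    have hlow : ENNReal.ofReal (t * (sC n * Real.exp (-1) * N) ^ (1 / q)) ≤
        weakLpE (fun x => pw n δ q x ^ q) (riesz α (tf n α r)) q := by
      refine le_trans ?_ (le_iSup₂ (f := fun (t : ℝ) (_ : 0 < t) => ENNReal.ofReal t *
        wMeas (fun x => pw n δ q x ^ q)
          {x | ENNReal.ofReal t < riesz α (tf n α r) x} ^ (1 / q)) t ht0)
      rw [ENNReal.ofReal_mul ht0.le]
      gcongr
      rw [← ENNReal.ofReal_rpow_of_nonneg (by positivity) (by positivity)]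
      apply ENNReal.rpow_le_rpow _ (by positivity)
      have e : sC n * Real.exp (-1) * N = sC n * (r ^ δ / δ) := by
        rw [hrδ, hδ]; field_simp
      rw [e, ← ball_int hn hδ0 hr0, wMeas]
      simp_rw [pw_rpow hq0]
      apply lintegral_mono_set
      intro x hx
      refine lt_of_lt_of_le ?_ (riesz_lower hn hαn hr0 hr1 hx)
      rw [hlog]
      apply (ENNReal.ofReal_lt_ofReal_iff (by positivity)).2
      have : 0 < 2 ^ (α - n) * (sC n * N) := by positivity
      rw [ht]; linarith
    have hw := wLp_le (α := α) hn hp hq0 hq hδ0 hr0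
    have hup : ENNReal.ofReal c * Apq p q (pw n δ q) ^ γ * wLp (pw n δ q) (tf n α r) p ≤
        ENNReal.ofReal (c * (cA n * N) ^ γ * (sC n * 2 ^ (p / q) / (p / q) * N) ^ (1 / p)) := by
      rw [ENNReal.ofReal_mul (by positivity), ENNReal.ofReal_mul (by positivity)]
      gcongr
      · rw [← ENNReal.ofReal_rpow_of_nonneg (by positivity) hγ0]
        apply ENNReal.rpow_le_rpow _ hγ0
        rwa [hδ, div_inv_eq_mul] at hAp
      · refine hw.trans (ENNReal.ofReal_le_ofReal ?_)
        apply Real.rpow_le_rpow (by positivity) _ (by positivity)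
        have h2 : (2:ℝ) ^ (δ * p / q) ≤ 2 ^ (p / q) := by
          apply Real.rpow_le_rpow_of_exponent_le one_le_two
          gcongr
          nlinarith
        calc sC n * (2 ^ (δ * p / q) / (δ * p / q)) ≤ sC n * (2 ^ (p / q) / (δ * p / q)) := by
              gcongr
          _ = _ := by rw [hδ]; field_simp
    have h3 := (ENNReal.ofReal_le_ofReal_iff (by positivity)).1 (hlow.trans (h.trans hup))
    rw [Real.mul_rpow (by positivity) hN0.le, Real.mul_rpow (by positivity) hN0.le,
      Real.mul_rpow (by positivity) hN0.le] at h3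
    have h4 : A * (N * N ^ (1 / q)) ≤ C * (N ^ γ * N ^ (1 / p)) := by
      rw [hA, hC]
      calc _ = _ := ?_
        _ ≤ _ := h3
        _ = _ := ?_
      · rw [ht]; ring
      · ring
    have h5 : N * N ^ (1 / q) = N ^ (1 - α / n - γ) * (N ^ γ * N ^ (1 / p)) := by
      nth_rewrite 1 [← Real.rpow_one N]
      rw [← Real.rpow_add hN0, ← Real.rpow_add hN0, ← Real.rpow_add hN0, hq]
      congr 1; ring
    rw [h5, ← mul_assoc] at h4
    have h6 := le_of_mul_le_mul_right h4 (by positivity)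
    rw [le_div_iff₀ hA0]
    linarith
  have hlim := tendsto_rpow_atTop (show 0 < 1 - α / n - γ by linarith)
  obtain ⟨N, hN1, hN2⟩ := ((hlim.eventually_gt_atTop (C / A)).and
    (Filter.eventually_gt_atTop 1)).exists
  exact absurd (key N hN2) (not_le.2 hN1)

end
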